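/- arXiv:1907.04383 — 3 statements merged into one kernel-verified Lean document; each statement's English description precedes it below -/
import Mathlib

section
/- Let (𝐀,𝐁) be a promise template over finite domains. Then (𝐀,𝐁) has block-symmetric polymorphisms of arbitrarily high width (for every N there exist L, a partition of [L] into blocks each of size at least N, and a polymorphism of arity L block-symmetric with respect to it) if and only if for every integer L ≥ 1 there is a polymorphism of (𝐀,𝐁) of arity 2L+1 that is block-symmetric with respect to a partition of [2L+1] into two blocks of sizes L and L+1. -/
/-- `f` is a polymorphism of the promise template given by relations `RA`, `RB`. -/
def IsPolymorphism {ι : Type} {ar : ι → ℕ} {A B : Type}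
    (RA : ∀ R : ι, Set (Fin (ar R) → A)) (RB : ∀ R : ι, Set (Fin (ar R) → B))
    {L : ℕ} (f : (Fin L → A) → B) : Prop :=
  ∀ R : ι, ∀ x : Fin L → (Fin (ar R) → A), (∀ l, x l ∈ RA R) →
    (fun k => f (fun l => x l k)) ∈ RB R

/-- `f` is block-symmetric with respect to the partition of `Fin L` into the
fibers of `blk`: it is invariant under all permutations preserving each fiber. -/
def IsBlockSymmetric {A B : Type} {L κ : ℕ} (blk : Fin L → Fin κ)
    (f : (Fin L → A) → B) : Prop :=
  ∀ π : Equiv.Perm (Fin L), (∀ i, blk (π i) = blk i) →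
    ∀ x : Fin L → A, f (x ∘ π) = f x

/-- A minor of a polymorphism is a polymorphism. -/
theorem IsPolymorphism.minor {ι : Type} {ar : ι → ℕ} {A B : Type}
    {RA : ∀ R : ι, Set (Fin (ar R) → A)} {RB : ∀ R : ι, Set (Fin (ar R) → B)}
    {L M : ℕ} {f : (Fin L → A) → B} (hf : IsPolymorphism RA RB f) (σ : Fin L → Fin M) :
    IsPolymorphism RA RB (fun x : Fin M → A => f (x ∘ σ)) :=
  fun R x hx => hf R (fun l => x (σ l)) fun l => hx (σ l)

/-- If within each block `b` of `blk` one can repeat every coordinate `j` of `Fin M` exactly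
`m b (blk' j)` times, then a minor of a `blk`-symmetric map is `blk'`-symmetric. -/
theorem IsBlockSymmetric.exists_minor {A B : Type} {L M κ κ' : ℕ} {blk : Fin L → Fin κ}
    {f : (Fin L → A) → B} (hf : IsBlockSymmetric blk f) (blk' : Fin M → Fin κ')
    (m : Fin κ → Fin κ' → ℕ)
    (hm : ∀ b, (Finset.univ.filter (fun i => blk i = b)).card = ∑ j, m b (blk' j)) :
    ∃ σ : Fin L → Fin M, IsBlockSymmetric blk' (fun x : Fin M → A => f (x ∘ σ)) := by
  have e (b : Fin κ) : Nonempty ({i // blk i = b} ≃ Σ j : Fin M, Fin (m b (blk' j))) := by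
    rw [← Fintype.card_eq, Fintype.card_subtype, hm]
    simp
  let E : Fin L ≃ Σ b : Fin κ, Σ j : Fin M, Fin (m b (blk' j)) :=
    (Equiv.sigmaFiberEquiv blk).symm.trans (Equiv.sigmaCongrRight fun b => (e b).some)
  have hE (p) : blk (E.symm p) = p.1 := by
    obtain ⟨i, rfl⟩ := E.surjective p
    rw [E.symm_apply_apply]
    rfl
  refine ⟨fun i => (E i).2.1, fun π hπ x => ?_⟩
  let T : Equiv.Perm (Σ b : Fin κ, Σ j : Fin M, Fin (m b (blk' j))) :=
    Equiv.sigmaCongrRight fun b =>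
      Equiv.sigmaCongr π fun j => finCongr (congrArg (m b) (hπ j).symm)
  have hT := hf (E.trans (T.trans E.symm)) (fun i => hE (T (E i))) (x ∘ fun i => (E i).2.1)
  refine Eq.trans (congrArg f ?_) hT
  funext i
  exact congrArg (fun p => x p.2.1) (E.apply_symm_apply (T (E i))).symm

/-- Every `n ≥ L * L` is a nonnegative integer combination of `L` and `L + 1`. -/
theorem exists_eq_mul_add_mul_succ {L n : ℕ} (hL : 1 ≤ L) (hn : L * L ≤ n) :
    ∃ p q : ℕ, n = L * p + (L + 1) * q := by
  have hle : n % L ≤ n / L :=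
    (Nat.mod_lt n hL).le.trans ((Nat.le_div_iff_mul_le hL).2 hn)
  obtain ⟨p, hp⟩ := Nat.exists_eq_add_of_le hle
  refine ⟨p, n % L, ?_⟩
  have h := Nat.div_add_mod n L
  rw [hp] at h
  linarith

/-- A promise template `(𝐀,𝐁)` over finite domains has block-symmetric
polymorphisms of arbitrarily high width iff for every `L ≥ 1` it has a polymorphism of
arity `2L+1` block-symmetric with respect to a partition of `[2L+1]` into two blocks of
sizes `L` and `L+1`. -/
theorem stmt_3 {ι : Type} [Fintype ι] {ar : ι → ℕ} (har : ∀ R, 1 ≤ ar R)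
    {A B : Type} [Fintype A] [Fintype B]
    (RA : ∀ R : ι, Set (Fin (ar R) → A))
    (RB : ∀ R : ι, Set (Fin (ar R) → B))
    (hAB : ∃ h : A → B, ∀ R : ι, ∀ t ∈ RA R, (fun k => h (t k)) ∈ RB R) :
    (∀ N : ℕ, ∃ (L κ : ℕ) (blk : Fin L → Fin κ) (f : (Fin L → A) → B),
        (∀ b, N ≤ (Finset.univ.filter (fun i => blk i = b)).card) ∧
        IsPolymorphism RA RB f ∧ IsBlockSymmetric blk f) ↔
    (∀ L : ℕ, 1 ≤ L →
        ∃ (blk : Fin (2 * L + 1) → Fin 2) (f : (Fin (2 * L + 1) → A) → B),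
          (Finset.univ.filter (fun i => blk i = 0)).card = L ∧
          (Finset.univ.filter (fun i => blk i = 1)).card = L + 1 ∧
          IsPolymorphism RA RB f ∧ IsBlockSymmetric blk f) := by
  constructor
  · intro h L hL
    obtain ⟨K, κ, blk, f, hcard, hpol, hsym⟩ := h (L * L)
    choose p q hpq using fun b => exists_eq_mul_add_mul_succ hL (hcard b)
    let blk' : Fin (2 * L + 1) → Fin 2 := fun i => if i.val < L then 0 else 1
    have h0 : (Finset.univ.filter (fun i => blk' i = 0)).card = L := by
      have : (Finset.univ.filter (fun i => blk' i = 0)) =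
          Finset.univ.filter (fun i : Fin (2 * L + 1) => i.val < L) := by
        ext i
        simp [blk']
      rw [this, Fin.card_filter_val_lt]
      omega
    have h1 : (Finset.univ.filter (fun i => blk' i = 1)).card = L + 1 := by
      have hsum := Finset.card_eq_sum_card_fiberwise (f := blk') (s := Finset.univ)
        (t := Finset.univ) (fun _ _ => Finset.mem_coe.2 (Finset.mem_univ _))
      rw [Fin.sum_univ_two, h0, Finset.card_univ, Fintype.card_fin] at hsum
      omega
    obtain ⟨σ, hσ⟩ := hsym.exists_minor blk' (fun b => ![p b, q b]) fun b => by
      rw [← Finset.sum_fiberwise' Finset.univ blk' (fun c => ![p b, q b] c)]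
      simpa [h0, h1] using hpq b
    exact ⟨blk', _, h0, h1, hpol.minor σ, hσ⟩
  · intro h N
    obtain ⟨blk, f, h0, h1, hpol, hsym⟩ := h (N + 1) (Nat.le_add_left 1 N)
    refine ⟨_, 2, blk, f, ?_, hpol, hsym⟩
    rw [Fin.forall_fin_two]
    omega
end

section
/- Let (𝐀,𝐁) be a promise template. If the minion 𝓜_{BLP+Aff} admits a minion homomorphism to Pol(𝐀,𝐁), then for every integer L ≥ 1 there is a polymorphism of (𝐀,𝐁) of arity 2L+1 that is block-symmetric with respect to the partition of [2L+1] into the set of odd coordinates (of size L+1) and the set of even coordinates (of size L). -/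
/-- An abstract minion: a family of sets indexed by arity, with minor operations. -/
structure Minion where
  carrier : ℕ → Type
  map : ∀ {L L' : ℕ}, (Fin L → Fin L') → carrier L → carrier L'
  map_id : ∀ (L : ℕ) (f : carrier L), map id f = f
  map_comp : ∀ {L L' L'' : ℕ} (π : Fin L → Fin L') (τ : Fin L' → Fin L'')
    (f : carrier L), map τ (map π f) = map (τ ∘ π) f

/-- A minion homomorphism: preserves arities and minors. -/
structure MinionHom (M N : Minion) where
  toFun : ∀ L, M.carrier L → N.carrier L
  map_minor : ∀ {L L' : ℕ} (π : Fin L → Fin L') (f : M.carrier L),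
    toFun L' (M.map π f) = N.map π (toFun L f)

/-- The defining conditions of an `L`-ary object `(w, r)` of the minion `𝓜_{BLP+Aff}`. -/
def BLPAffCond (L : ℕ) (w : Fin L → ℚ) (r : Fin L → ℤ) : Prop :=
  (∀ i, 0 ≤ w i) ∧ (∑ i, w i = 1) ∧ (∑ i, r i = 1) ∧ (∀ i, w i = 0 → r i = 0)

/-- The minion `𝓜_{BLP+Aff}`. -/
def MBLPAff : Minion where
  carrier L := {wr : (Fin L → ℚ) × (Fin L → ℤ) // BLPAffCond L wr.1 wr.2}
  map {L L'} π wr :=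
    ⟨(fun i => ∑ j ∈ Finset.univ.filter (fun j => π j = i), wr.1.1 j,
      fun i => ∑ j ∈ Finset.univ.filter (fun j => π j = i), wr.1.2 j), by
      obtain ⟨hw0, hw1, hr1, hz⟩ := wr.2
      refine ⟨fun i => Finset.sum_nonneg fun j _ => hw0 j, ?_, ?_, ?_⟩
      · exact (Finset.sum_fiberwise Finset.univ π wr.1.1).trans hw1
      · exact (Finset.sum_fiberwise Finset.univ π wr.1.2).trans hr1
      · intro i hi
        have hw' : ∑ j ∈ Finset.univ.filter (fun j => π j = i), wr.1.1 j = 0 := hi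
        exact Finset.sum_eq_zero fun j hj =>
          hz j ((Finset.sum_eq_zero_iff_of_nonneg fun j _ => hw0 j).1 hw' j hj)⟩
  map_id := by
    intro L f
    apply Subtype.ext
    refine Prod.ext ?_ ?_ <;> funext i <;>
      simp [Finset.sum_filter, Finset.sum_ite_eq']
  map_comp := by
    intro L L' L'' π τ f
    apply Subtype.ext
    refine Prod.ext ?_ ?_ <;> funext i <;>
    · show ∑ i' ∈ Finset.univ.filter (fun i' => τ i' = i),
        ∑ j ∈ Finset.univ.filter (fun j => π j = i'), _ = _
      have hset : (Finset.univ.filter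
          (fun j => π j ∈ Finset.univ.filter (fun i' => τ i' = i)))
          = Finset.univ.filter (fun j => τ (π j) = i) := by
        ext j; simp
      rw [Finset.sum_fiberwise_eq_sum_filter Finset.univ
        (Finset.univ.filter (fun i' => τ i' = i)) π _, hset]
      rfl

/-- The polymorphism minion `Pol(𝐀,𝐁)`. -/
def PolMinion {ι : Type} {ar : ι → ℕ} {A B : Type}
    (RA : ∀ R : ι, Set (Fin (ar R) → A)) (RB : ∀ R : ι, Set (Fin (ar R) → B)) :
    Minion where
  carrier L := {f : (Fin L → A) → B // IsPolymorphism RA RB f}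
  map {L L'} π f := ⟨fun x => f.1 (x ∘ π),
    fun R x hx => f.2 R (fun l => x (π l)) (fun l => hx (π l))⟩
  map_id := fun _ _ => rfl
  map_comp := fun _ _ _ => rfl

open Finset in
theorem card_filter_val_mod_two_eq (L : ℕ) :
    (univ.filter (fun i : Fin (2 * L + 1) => i.1 % 2 = 0)).card = L + 1 ∧
      (univ.filter (fun i : Fin (2 * L + 1) => i.1 % 2 = 1)).card = L := by
  simp only [card_filter]
  rw [Fin.sum_univ_eq_sum_range (fun i => if i % 2 = 0 then 1 else 0),
    Fin.sum_univ_eq_sum_range (fun i => if i % 2 = 1 then 1 else 0)]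
  induction L with
  | zero => decide
  | succ L ih =>
    rw [show 2 * (L + 1) + 1 = 2 * L + 1 + 1 + 1 by ring]
    simp only [sum_range_succ _ (2 * L + 1), sum_range_succ _ (2 * L + 1 + 1), ih.1, ih.2]
    constructor <;> split_ifs <;> omega

/-- The uniform distribution on `2 * L + 1` points, with the alternating integer weights
`1, -1, 1, …, 1`, is an object of the minion. -/
theorem blpAffCond_uniform_alternating (L : ℕ) :
    BLPAffCond (2 * L + 1) (fun _ => ((2 * L + 1 : ℕ) : ℚ)⁻¹) (fun i => (-1) ^ i.1) := by
  refine ⟨fun i => by positivity, ?_, ?_, fun i h => absurd h (by positivity)⟩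
  · rw [Finset.sum_const, Finset.card_univ, Fintype.card_fin, nsmul_eq_mul]
    exact mul_inv_cancel₀ (by positivity)
  · rw [Fin.sum_univ_eq_sum_range (fun i => (-1 : ℤ) ^ i), neg_one_geom_sum]
    simp

/-- An object of `MBLPAff` whose weights are invariant under a permutation is equal to the
corresponding minor. -/
theorem MBLPAff_map_perm_eq_self {L : ℕ} (π : Equiv.Perm (Fin L)) (f : MBLPAff.carrier L)
    (hw : ∀ i, f.1.1 (π i) = f.1.1 i) (hr : ∀ i, f.1.2 (π i) = f.1.2 i) :
    MBLPAff.map π f = f := by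
  have hfib : ∀ i, Finset.univ.filter (fun j => π j = i) = {π.symm i} := by
    intro i
    ext j
    simp [Equiv.eq_symm_apply]
  apply Subtype.ext
  refine Prod.ext (funext fun i => ?_) (funext fun i => ?_)
  · change ∑ j ∈ Finset.univ.filter (fun j => π j = i), f.1.1 j = f.1.1 i
    rw [hfib, Finset.sum_singleton, ← hw, Equiv.apply_symm_apply]
  · change ∑ j ∈ Finset.univ.filter (fun j => π j = i), f.1.2 j = f.1.2 i
    rw [hfib, Finset.sum_singleton, ← hr, Equiv.apply_symm_apply]

/-- If `𝓜_{BLP+Aff}` admits a minion homomorphism to `Pol(𝐀,𝐁)`, then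
for every `L ≥ 1` there is a polymorphism of `(𝐀,𝐁)` of arity `2L+1` that is
block-symmetric with respect to the partition of the coordinates into those of even
index (the odd coordinates `1,3,…,2L+1` in one-based numbering, `L+1` of them) and those
of odd index (the even coordinates, `L` of them). -/
theorem stmt_5 {ι : Type} [Fintype ι] {ar : ι → ℕ} (har : ∀ R, 1 ≤ ar R)
    {A B : Type} [Fintype A] [Fintype B]
    (RA : ∀ R : ι, Set (Fin (ar R) → A))
    (RB : ∀ R : ι, Set (Fin (ar R) → B))
    (hAB : ∃ h : A → B, ∀ R : ι, ∀ t ∈ RA R, (fun k => h (t k)) ∈ RB R)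
    (hhom : Nonempty (MinionHom MBLPAff (PolMinion RA RB))) :
    ∀ L : ℕ, 1 ≤ L →
      ∃ f : (Fin (2 * L + 1) → A) → B,
        IsPolymorphism RA RB f ∧
        IsBlockSymmetric (fun i => (⟨i.1 % 2, by omega⟩ : Fin 2)) f ∧
        (Finset.univ.filter (fun i : Fin (2 * L + 1) => i.1 % 2 = 0)).card = L + 1 ∧
        (Finset.univ.filter (fun i : Fin (2 * L + 1) => i.1 % 2 = 1)).card = L := by
  obtain ⟨ξ⟩ := hhom
  intro L _
  let m : MBLPAff.carrier (2 * L + 1) := ⟨(_, _), blpAffCond_uniform_alternating L⟩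
  let f := ξ.toFun (2 * L + 1) m
  refine ⟨f.1, f.2, fun π hπ x => ?_, card_filter_val_mod_two_eq L⟩
  have hm : MBLPAff.map π m = m := by
    refine MBLPAff_map_perm_eq_self π m (fun _ => rfl) fun i => ?_
    have hmod : (π i).1 % 2 = i.1 % 2 := congrArg Fin.val (hπ i)
    change (-1 : ℤ) ^ (π i).1 = (-1) ^ i.1
    rw [neg_one_pow_eq_pow_mod_two, hmod, ← neg_one_pow_eq_pow_mod_two]
  have hf := ξ.map_minor π m
  rw [hm] at hf
  exact (congrFun (congrArg Subtype.val hf) x).symm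
end

section
/- Let (𝐀,𝐁) be a promise template with finite domains. If (𝐀,𝐁) has block-symmetric polymorphisms of arbitrarily high width (for every N there exist L, a partition of [L] into blocks each of size at least N, and a polymorphism of arity L block-symmetric with respect to it), then the minion 𝓜_{BLP+Aff} admits a minion homomorphism to Pol(𝐀,𝐁). -/
/-- Two maps out of a finite type with equal fiber cardinalities differ by a permutation. -/
theorem exists_perm_comp_eq_of_card_fiber {S T : Type*} [Fintype S] [DecidableEq T]
    (u v : S → T)
    (h : ∀ t, (Finset.univ.filter fun s => u s = t).card =
      (Finset.univ.filter fun s => v s = t).card) :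
    ∃ π : Equiv.Perm S, ∀ s, u (π s) = v s := by
  have e : ∀ t, Nonempty ({s // v s = t} ≃ {s // u s = t}) := fun t =>
    ⟨Fintype.equivOfCardEq (by simp only [Fintype.card_subtype, h])⟩
  exact ⟨Equiv.ofFiberEquiv fun t => (e t).some, Equiv.ofFiberEquiv_map _⟩

/-- A map `u : S → T` refines to a map `S → T × I` with prescribed fiber cardinalities, as soon
as these add up to the fiber cardinalities of `u`. -/
theorem exists_refinement_card_fiber {S T I : Type*} [Fintype S] [Fintype T] [Fintype I]
    [DecidableEq T] [DecidableEq I] (u : S → T) (W : T → I → ℕ)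
    (hW : ∀ t, ∑ i, W t i = (Finset.univ.filter fun s => u s = t).card) :
    ∃ p : S → I, ∀ t i,
      (Finset.univ.filter fun s => u s = t ∧ p s = i).card = W t i := by
  have hfib : ∀ t, Nonempty ({s // u s = t} ≃ {z : Σ t, Σ i, Fin (W t i) // z.1 = t}) := fun t =>
    ⟨(Fintype.equivOfCardEq (by simp [Fintype.card_subtype, hW])).trans
      (Equiv.sigmaSubtype (β := fun t => Σ i, Fin (W t i)) t).symm⟩
  let e : S ≃ Σ t, Σ i, Fin (W t i) := Equiv.ofFiberEquiv fun t => (hfib t).some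
  have he : ∀ s, (e s).1 = u s := Equiv.ofFiberEquiv_map _
  refine ⟨fun s => (e s).2.1, fun t i => ?_⟩
  rw [← Finset.card_fin (W t i)]
  refine (Finset.card_bij (fun k _ => e.symm ⟨t, i, k⟩) (fun k _ => ?_) (fun k _ k' _ h => ?_)
    fun s hs => ?_).symm
  · simp only [Finset.mem_filter, Finset.mem_univ, true_and, ← he]
    rw [e.apply_symm_apply]
    exact ⟨rfl, rfl⟩
  · simpa using h
  · simp only [Finset.mem_filter, Finset.mem_univ, true_and, ← he] at hs
    obtain ⟨rfl, rfl⟩ := hs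
    exact ⟨(e s).2.2, Finset.mem_univ _, e.symm_apply_apply s⟩

/-- The map `p` splits every fiber of `blk` into parts of the sizes that the weights `w`, scaled
to the largest multiple of `ℓ` below the fiber size, and `r`, scaled to the remainder, prescribe. -/
def Realizes (ℓ : ℕ) {L κ n : ℕ} (blk : Fin L → Fin κ) (w : Fin n → ℚ) (r : Fin n → ℤ)
    (p : Fin L → Fin n) : Prop :=
  ∀ b i, ((Finset.univ.filter fun l => blk l = b ∧ p l = i).card : ℚ) =
    ((Finset.univ.filter fun l => blk l = b).card / ℓ : ℕ) * ℓ * w i +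
      ((Finset.univ.filter fun l => blk l = b).card % ℓ : ℕ) * r i

theorem IsBlockSymmetric.comp_eq {A B : Type} {L κ n : ℕ} {blk : Fin L → Fin κ}
    {f : (Fin L → A) → B} (hf : IsBlockSymmetric blk f) {ℓ : ℕ} {w : Fin n → ℚ}
    {r : Fin n → ℤ} {p q : Fin L → Fin n} (hp : Realizes ℓ blk w r p)
    (hq : Realizes ℓ blk w r q) (x : Fin n → A) : f (x ∘ p) = f (x ∘ q) := by
  obtain ⟨π, hπ⟩ := exists_perm_comp_eq_of_card_fiber (fun l => (blk l, p l))
    (fun l => (blk l, q l)) fun t => by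
      have := (hp t.1 t.2).trans (hq t.1 t.2).symm
      simpa only [Prod.ext_iff, Nat.cast_inj] using this
  simp only [Prod.mk.injEq] at hπ
  rw [← hf π (fun l => (hπ l).1) (x ∘ p)]
  exact congrArg f (funext fun l => congrArg x (hπ l).2)

theorem Realizes.minor {ℓ L κ n m : ℕ} {blk : Fin L → Fin κ} {wr : MBLPAff.carrier n}
    {p : Fin L → Fin n} (hp : Realizes ℓ blk wr.1.1 wr.1.2 p) (π : Fin n → Fin m) :
    Realizes ℓ blk (MBLPAff.map π wr).1.1 (MBLPAff.map π wr).1.2 (π ∘ p) := by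
  intro b i
  have hcard : (Finset.univ.filter fun l => blk l = b ∧ (π ∘ p) l = i).card =
      ∑ j ∈ Finset.univ.filter (fun j => π j = i),
        (Finset.univ.filter fun l => blk l = b ∧ p l = j).card := by
    rw [Finset.card_eq_sum_card_fiberwise (f := p)
      (t := Finset.univ.filter fun j => π j = i) (fun l hl => by simp_all)]
    refine Finset.sum_congr rfl fun j hj => congrArg Finset.card ?_
    ext l
    simp only [Finset.mem_filter, Finset.mem_univ, true_and, Function.comp_apply] at hj ⊢
    exact ⟨fun h => ⟨h.1.1, h.2⟩, fun h => ⟨⟨h.1, h.2 ▸ hj⟩, h.2⟩⟩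
  have hw : (MBLPAff.map π wr).1.1 i = ∑ j ∈ Finset.univ.filter (fun j => π j = i), wr.1.1 j := rfl
  have hr : (MBLPAff.map π wr).1.2 i = ∑ j ∈ Finset.univ.filter (fun j => π j = i), wr.1.2 j := rfl
  rw [hcard, hw, hr, Nat.cast_sum, Int.cast_sum, Finset.mul_sum, Finset.mul_sum,
    ← Finset.sum_add_distrib]
  exact Finset.sum_congr rfl fun j _ => hp b j

theorem BLPAffCond.exists_realizes {L κ n ℓ M : ℕ} {blk : Fin L → Fin κ} {w : Fin n → ℚ}
    {r : Fin n → ℤ} (h : BLPAffCond n w r) (hℓ : 0 < ℓ)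
    (hden : ∀ i, (w i).den ∣ ℓ) (hr : ∀ i, |r i| ≤ M)
    (hblk : ∀ b, ℓ * (ℓ * M) ≤ (Finset.univ.filter fun l => blk l = b).card) :
    ∃ p, Realizes ℓ blk w r p := by
  obtain ⟨hw0, hw1, hr1, hz⟩ := h
  let c : Fin κ → ℕ := fun b => (Finset.univ.filter fun l => blk l = b).card
  have hnat : ∀ i, ∃ z : ℕ, (ℓ : ℚ) * w i = z := by
    intro i
    obtain ⟨k, hk⟩ := hden i
    have hnum : ((w i).num.toNat : ℤ) = (w i).num := Int.toNat_of_nonneg (Rat.num_nonneg.2 (hw0 i))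
    refine ⟨k * (w i).num.toNat, ?_⟩
    have hmul : w i * (w i).den = (w i).num := Rat.mul_den_eq_num (w i)
    have hcast : (((w i).num.toNat : ℕ) : ℚ) = (w i).num := by exact_mod_cast hnum
    rw [Nat.cast_mul, hcast, ← hmul]
    conv_lhs => rw [hk]
    push_cast
    ring
  choose z hz' using hnat
  have hnonneg : ∀ b i, 0 ≤ ((c b / ℓ : ℕ) : ℤ) * z i + ((c b % ℓ : ℕ) : ℤ) * r i := by
    intro b i
    rcases Nat.eq_zero_or_pos (z i) with h0 | hpos
    · have hwi : w i = 0 := by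
        have := hz' i
        rw [h0, Nat.cast_zero, mul_eq_zero] at this
        exact this.resolve_left (by positivity)
      simp [h0, hz i hwi]
    · have hq : ((ℓ * M : ℕ) : ℤ) ≤ (c b / ℓ : ℕ) := by
        exact_mod_cast (Nat.le_div_iff_mul_le hℓ).2 (by rw [mul_comm]; exact hblk b)
      have hs : ((c b % ℓ : ℕ) : ℤ) ≤ ℓ := by exact_mod_cast (Nat.mod_lt _ hℓ).le
      have hri : -(M : ℤ) ≤ r i := (abs_le.1 (hr i)).1
      have hz1 : (1 : ℤ) ≤ z i := by exact_mod_cast hpos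
      have h1 : ((c b / ℓ : ℕ) : ℤ) ≤ ((c b / ℓ : ℕ) : ℤ) * z i :=
        le_mul_of_one_le_right (by positivity) hz1
      have h2 : ((c b % ℓ : ℕ) : ℤ) * -M ≤ ((c b % ℓ : ℕ) : ℤ) * r i :=
        mul_le_mul_of_nonneg_left hri (by positivity)
      have h3 : ((c b % ℓ : ℕ) : ℤ) * M ≤ ℓ * M := mul_le_mul_of_nonneg_right hs (by positivity)
      push_cast at hq h1 h2 h3 ⊢
      linarith
  let W : Fin κ → Fin n → ℕ := fun b i =>
    (((c b / ℓ : ℕ) : ℤ) * z i + ((c b % ℓ : ℕ) : ℤ) * r i).toNat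
  have hW : ∀ b i, (W b i : ℚ) = (c b / ℓ : ℕ) * ℓ * w i + (c b % ℓ : ℕ) * r i := by
    intro b i
    have hi : (W b i : ℤ) = ((c b / ℓ : ℕ) : ℤ) * z i + ((c b % ℓ : ℕ) : ℤ) * r i :=
      Int.toNat_of_nonneg (hnonneg b i)
    rw [mul_assoc, hz', ← Int.cast_natCast (W b i), hi]
    push_cast
    rfl
  obtain ⟨p, hp⟩ := exists_refinement_card_fiber blk W fun b => by
    have hr1' : ∑ i, (r i : ℚ) = 1 := by exact_mod_cast hr1
    have hsum : ((∑ i, W b i : ℕ) : ℚ) = c b := by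
      rw [Nat.cast_sum, Finset.sum_congr rfl fun i _ => hW b i, Finset.sum_add_distrib,
        ← Finset.mul_sum, ← Finset.mul_sum, hw1, hr1', mul_one, mul_one]
      exact_mod_cast Nat.div_add_mod' (c b) ℓ
    exact_mod_cast hsum
  exact ⟨p, fun b i => by rw [hp]; exact hW b i⟩

/-- Given block sizes growing fast enough, every object of `𝓜_{BLP+Aff}` is eventually realized. -/
theorem MBLPAff.eventually_exists_realizes {L κ : ℕ → ℕ} (blk : ∀ N, Fin (L N) → Fin (κ N))
    (hblk : ∀ N b, N.factorial * (N.factorial * N) ≤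
      (Finset.univ.filter fun l => blk N l = b).card)
    {n : ℕ} (wr : MBLPAff.carrier n) :
    ∀ᶠ N in Filter.atTop, ∃ p, Realizes N.factorial (blk N) wr.1.1 wr.1.2 p := by
  have hden : ∀ᶠ N : ℕ in Filter.atTop, ∀ i, (wr.1.1 i).den ≤ N :=
    Filter.eventually_all.2 fun i => Filter.eventually_ge_atTop _
  have hr : ∀ᶠ N : ℕ in Filter.atTop, ∀ i, (wr.1.2 i).natAbs ≤ N :=
    Filter.eventually_all.2 fun i => Filter.eventually_ge_atTop _
  filter_upwards [hden, hr] with N hN hN'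
  refine wr.2.exists_realizes N.factorial_pos
    (fun i => Nat.dvd_factorial (wr.1.1 i).den_pos (hN i)) (fun i => ?_) (hblk N)
  rw [Int.abs_eq_natAbs]
  exact_mod_cast hN' i

/-- If a promise template `(𝐀,𝐁)` with finite domains has
block-symmetric polymorphisms of arbitrarily high width, then `𝓜_{BLP+Aff}` admits a
minion homomorphism to `Pol(𝐀,𝐁)`. -/
theorem stmt_6 {ι : Type} [Fintype ι] {ar : ι → ℕ} (har : ∀ R, 1 ≤ ar R)
    {A B : Type} [Fintype A] [Fintype B]
    (RA : ∀ R : ι, Set (Fin (ar R) → A))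
    (RB : ∀ R : ι, Set (Fin (ar R) → B))
    (hAB : ∃ h : A → B, ∀ R : ι, ∀ t ∈ RA R, (fun k => h (t k)) ∈ RB R)
    (hblocks : ∀ N : ℕ, ∃ (L κ : ℕ) (blk : Fin L → Fin κ) (f : (Fin L → A) → B),
      (∀ b, N ≤ (Finset.univ.filter (fun i => blk i = b)).card) ∧
      IsPolymorphism RA RB f ∧ IsBlockSymmetric blk f) :
    Nonempty (MinionHom MBLPAff (PolMinion RA RB)) := by
  choose L κ blk f hblk hpol hsym using fun N : ℕ =>
    hblocks (N.factorial * (N.factorial * N))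
  let U : Ultrafilter ℕ := Filter.hyperfilter ℕ
  have hreal : ∀ {n : ℕ} (wr : MBLPAff.carrier n),
      ∀ᶠ N in (U : Filter ℕ), ∃ p, Realizes N.factorial (blk N) wr.1.1 wr.1.2 p := fun wr =>
    (MBLPAff.eventually_exists_realizes blk hblk wr).filter_mono Nat.hyperfilter_le_atTop
  have hlim : ∀ (n : ℕ) (wr : MBLPAff.carrier n) (x : Fin n → A), ∃ b : B,
      ∀ᶠ N in (U : Filter ℕ),
        ∃ p, Realizes N.factorial (blk N) wr.1.1 wr.1.2 p ∧ f N (x ∘ p) = b := by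
    intro n wr x
    have h : (⋃ b ∈ (Set.univ : Set B), {N | ∃ p,
        Realizes N.factorial (blk N) wr.1.1 wr.1.2 p ∧ f N (x ∘ p) = b}) ∈ U := by
      filter_upwards [hreal wr] with N ⟨p, hp⟩
      exact Set.mem_biUnion (Set.mem_univ (f N (x ∘ p))) ⟨p, hp, rfl⟩
    obtain ⟨b, -, hb⟩ := (Ultrafilter.finite_biUnion_mem_iff Set.finite_univ).1 h
    exact ⟨b, hb⟩
  choose ξ hξ using hlim
  refine ⟨⟨fun n wr => ⟨ξ n wr, fun R x hx => ?_⟩, fun {n m} π wr => ?_⟩⟩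
  · have hall : ∀ᶠ N in (U : Filter ℕ), ∀ k, ∃ p,
        Realizes N.factorial (blk N) wr.1.1 wr.1.2 p ∧
          f N ((fun l => x l k) ∘ p) = ξ n wr (fun l => x l k) :=
      Filter.eventually_all.2 fun k => hξ n wr _
    obtain ⟨N, ⟨p, hp⟩, hN⟩ := ((hreal wr).and hall).exists
    have heq : (fun k => ξ n wr (fun l => x l k)) = fun k => f N (fun l => x (p l) k) := by
      funext k
      obtain ⟨q, hq, hqk⟩ := hN k
      rw [← hqk, (hsym N).comp_eq hq hp]
      rfl
    rw [heq]
    exact hpol N R (fun l => x (p l)) fun l => hx (p l)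
  · refine Subtype.ext (funext fun x => ?_)
    obtain ⟨N, ⟨p, hp, hpx⟩, q, hq, hqx⟩ :=
      ((hξ m (MBLPAff.map π wr) x).and (hξ n wr (x ∘ π))).exists
    change ξ m (MBLPAff.map π wr) x = ξ n wr (x ∘ π)
    rw [← hpx, ← hqx, (hsym N).comp_eq hp (hq.minor π)]
    rfl
end
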